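/- arXiv:1402.2486 — 8 statements merged into one kernel-verified Lean document; each statement's English description precedes it below -/
import Mathlib

section
/- Let U and W be 𝔽_q-subspaces of (𝔽_{q^n})^r with dim_{𝔽_q} U = n and dim_{𝔽_q} W = rn − n. Then no nonzero vector of U is an 𝔽_{q^n}-scalar multiple of a nonzero vector of W if and only if no nonzero vector of W^⊥ is an 𝔽_{q^n}-scalar multiple of a nonzero vector of U^⊥ (here dim_{𝔽_q} W^⊥ = n and dim_{𝔽_q} U^⊥ = rn − n). That is, (U, W) is a BEL-configuration with respect to the Desarguesian spread if and only if (W^⊥, U^⊥) is. -/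
open Module in
/-- Subspaces of complementary dimension are disjoint iff their orthogonals are. -/
theorem LinearMap.BilinForm.disjoint_orthogonal_iff {F E : Type*} [Field F] [AddCommGroup E]
    [Module F E] [FiniteDimensional F E] {B : LinearMap.BilinForm F E} (hB : B.Nondegenerate)
    (hr : B.IsRefl) {U V : Submodule F E} (h : finrank F U + finrank F V = finrank F E) :
    Disjoint (B.orthogonal U) (B.orthogonal V) ↔ Disjoint U V := by
  have key : ∀ {U V : Submodule F E}, finrank F U + finrank F V = finrank F E → Disjoint U V →
      Disjoint (B.orthogonal U) (B.orthogonal V) := by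
    intro U V h hd
    have htop : U ⊔ V = ⊤ := Submodule.eq_top_of_disjoint U V h.ge hd
    have hle : U ⊔ V ≤ B.orthogonal (B.orthogonal U ⊓ B.orthogonal V) :=
      sup_le
        ((LinearMap.BilinForm.le_orthogonal_orthogonal hr).trans
          (LinearMap.BilinForm.orthogonal_le inf_le_left))
        ((LinearMap.BilinForm.le_orthogonal_orthogonal hr).trans
          (LinearMap.BilinForm.orthogonal_le inf_le_right))
    rw [htop] at hle
    rw [Submodule.disjoint_def]
    intro x hxU hxV
    exact hB.1 x fun y => hle (Submodule.mem_top : y ∈ ⊤) x ⟨hxU, hxV⟩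
  refine ⟨fun hd => ?_, key h⟩
  have := key (U := B.orthogonal U) (V := B.orthogonal V) ?_ hd
  · rwa [LinearMap.BilinForm.orthogonal_orthogonal hB hr,
      LinearMap.BilinForm.orthogonal_orthogonal hB hr] at this
  · rw [LinearMap.BilinForm.finrank_orthogonal hB, LinearMap.BilinForm.finrank_orthogonal hB]
    omega

/-- The `F`-bilinear form `(x, y) ↦ tr (∑ i, x i * y i)` on `ι → K`. -/
noncomputable def traceDotForm (F K ι : Type*) [Field F] [Field K] [Algebra F K] [Fintype ι] :
    LinearMap.BilinForm F (ι → K) :=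
  LinearMap.mk₂ F (fun x y => Algebra.trace F K (∑ i, x i * y i))
    (fun x y z => by simp [add_mul, Finset.sum_add_distrib])
    (fun c x y => by rw [← map_smul, Finset.smul_sum]; simp)
    (fun x y z => by simp [mul_add, Finset.sum_add_distrib])
    (fun c x y => by rw [← map_smul, Finset.smul_sum]; simp)

section traceDotForm

variable {F K ι : Type*} [Field F] [Field K] [Algebra F K] [Fintype ι]

theorem traceDotForm_apply (x y : ι → K) :
    traceDotForm F K ι x y = Algebra.trace F K (∑ i, x i * y i) := rfl

theorem traceDotForm_isSymm : (traceDotForm F K ι).IsSymm :=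
  ⟨fun x y => by simp [traceDotForm_apply, mul_comm]⟩

theorem traceDotForm_smul_left (a : K) (x y : ι → K) :
    traceDotForm F K ι (a • x) y = traceDotForm F K ι x (a • y) := by
  simp [traceDotForm_apply, mul_left_comm, mul_assoc]

theorem traceDotForm_nondegenerate [FiniteDimensional F K] [Algebra.IsSeparable F K] :
    (traceDotForm F K ι).Nondegenerate := by
  classical
  have hl : ∀ x : ι → K, (∀ y, traceDotForm F K ι x y = 0) → x = 0 := by
    intro x hx
    funext i
    refine (traceForm_nondegenerate F K).1 (x i) fun k => ?_
    simpa [traceDotForm_apply, Pi.single_apply, Algebra.traceForm_apply] using hx (Pi.single i k)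
  exact ⟨hl, fun y hy => hl y fun x => (traceDotForm_isSymm.eq x y).symm.trans (hy x)⟩

theorem mem_orthogonal_map_smul_iff (W : Submodule F (ι → K)) (a : Kˣ) (x : ι → K) :
    x ∈ (traceDotForm F K ι).orthogonal
      (W.map (DistribMulAction.toLinearEquiv F (ι → K) a).toLinearMap) ↔
    (a : K) • x ∈ (traceDotForm F K ι).orthogonal W := by
  simp only [LinearMap.BilinForm.mem_orthogonal_iff, Submodule.mem_map,
    forall_exists_index, and_imp, forall_apply_eq_imp_iff₂]
  exact forall₂_congr fun w _ => by rw [← traceDotForm_smul_left]; rfl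

end traceDotForm

/-- No nonzero vector of `U` is a `K`-multiple of a nonzero vector of `W` iff `U` is disjoint from
all the multiples of `W` by units. -/
theorem not_exists_eq_mul_iff_forall_disjoint {F K ι : Type*} [Field F] [Field K] [Algebra F K]
    (U W : Submodule F (ι → K)) :
    (¬ ∃ u ∈ U, u ≠ 0 ∧ ∃ w ∈ W, w ≠ 0 ∧ ∃ α : K, u = fun i => α * w i) ↔
    ∀ a : Kˣ, Disjoint U (W.map (DistribMulAction.toLinearEquiv F (ι → K) a).toLinearMap) := by
  constructor
  · intro h a
    rw [Submodule.disjoint_def]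
    rintro _ hu ⟨w, hw, rfl⟩
    by_contra h0
    exact h ⟨_, hu, h0, w, hw, fun hw0 => h0 (by rw [hw0, map_zero]), a, rfl⟩
  · rintro h ⟨u, hu, hu0, w, hw, -, α, rfl⟩
    have hα : α ≠ 0 := by
      rintro rfl
      exact hu0 (by ext; simp)
    exact hu0 (Submodule.disjoint_def.1 (h (Units.mk0 α hα)) _ hu ⟨w, hw, rfl⟩)

/-- `(U,W)` is a BEL-configuration iff `(W^⊥, U^⊥)` is, where `⊥` is taken
with respect to the form `b(u,v) = tr(Σ u_i v_i)`. -/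
theorem stmt7 (F K : Type*) [Field F] [Field K] [Algebra F K] [Fintype F] [Fintype K]
    (n r : ℕ) (hn : Module.finrank F K = n) (hr : 2 ≤ r)
    (U W : Submodule F (Fin r → K))
    (hU : Module.finrank F U = n) (hW : Module.finrank F W = r * n - n) :
    (¬ ∃ u ∈ U, u ≠ 0 ∧ ∃ w ∈ W, w ≠ 0 ∧ ∃ α : K, u = fun i => α * w i) ↔
    (¬ ∃ u ∈ {x : Fin r → K | ∀ w ∈ W, Algebra.trace F K (∑ i, w i * x i) = 0}, u ≠ 0 ∧
        ∃ w ∈ {x : Fin r → K | ∀ u' ∈ U, Algebra.trace F K (∑ i, u' i * x i) = 0}, w ≠ 0 ∧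
          ∃ α : K, u = fun i => α * w i) := by
  have hle : n ≤ r * n := Nat.le_mul_of_pos_left n (by omega)
  have hdim (a : Kˣ) : Module.finrank F U + Module.finrank F
      (W.map (DistribMulAction.toLinearEquiv F (Fin r → K) a).toLinearMap) =
      Module.finrank F (Fin r → K) := by
    rw [LinearEquiv.finrank_map_eq, hU, hW, Module.finrank_pi_fintype]
    simp only [hn, Finset.sum_const, Finset.card_univ, Fintype.card_fin, smul_eq_mul]
    omega
  rw [not_exists_eq_mul_iff_forall_disjoint]
  refine Iff.trans ?_ (not_exists_eq_mul_iff_forall_disjoint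
    ((traceDotForm F K (Fin r)).orthogonal W) ((traceDotForm F K (Fin r)).orthogonal U)).symm
  refine forall_congr' fun a => ?_
  rw [← LinearMap.BilinForm.disjoint_orthogonal_iff traceDotForm_nondegenerate
    traceDotForm_isSymm.isRefl (hdim a), Submodule.disjoint_def, Submodule.disjoint_def]
  constructor
  · rintro h _ hx ⟨y, hy, rfl⟩
    rw [h y hy ((mem_orthogonal_map_smul_iff W a y).2 hx), map_zero]
  · intro h y hy hx
    have h0 := h _ ((mem_orthogonal_map_smul_iff W a y).1 hx) ⟨y, hy, rfl⟩
    exact (smul_eq_zero_iff_right a.ne_zero).1 h0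
end

section
/- Let f = (f_1,…,f_r) and g = (g_1,…,g_r) be r-tuples of 𝔽_q-linear maps 𝔽_{q^n} → 𝔽_{q^n}, with trace-adjoints f̂_i and ĝ_i. Then for all x, y, z ∈ 𝔽_{q^n}: tr( (Σ_{i=1}^r g_i(f_i(x)·y)) · z ) = tr( x · (Σ_{i=1}^r f̂_i(ĝ_i(z)·y)) ). Equivalently, for each y the trace-adjoint of the 𝔽_q-linear map x ↦ S_{f,g}(x,y) is the map z ↦ S_{ĝ,f̂}(z,y); that is, the transpose of the presemifield S_{f,g} is S_{ĝ,f̂}. -/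
/-- the transpose of the presemifield `S_{f,g}` is `S_{ĝ,f̂}`: for each `y`
the trace-adjoint of `x ↦ S_{f,g}(x,y)` is `z ↦ S_{ĝ,f̂}(z,y)`. -/
theorem stmt9 (F K : Type*) [Field F] [Field K] [Algebra F K] [Fintype F] [Fintype K]
    (n r : ℕ) (hn : Module.finrank F K = n) (hr : 2 ≤ r)
    (f g fhat ghat : Fin r → (K →ₗ[F] K))
    (hf : ∀ i, ∀ x y : K,
      Algebra.trace F K (f i x * y) = Algebra.trace F K (x * fhat i y))
    (hg : ∀ i, ∀ x y : K,
      Algebra.trace F K (g i x * y) = Algebra.trace F K (x * ghat i y)) :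
    ∀ x y z : K,
      Algebra.trace F K ((∑ i, g i (f i x * y)) * z)
        = Algebra.trace F K (x * ∑ i, fhat i (ghat i z * y)) := by
  intro x y z
  simp only [Finset.sum_mul, Finset.mul_sum, map_sum]
  refine Finset.sum_congr rfl fun i _ => ?_
  rw [hg, mul_assoc, mul_comm y, hf]
end

section
/- Let S and S' be 𝔽_q-bilinear maps 𝔽_{q^n} × 𝔽_{q^n} → 𝔽_{q^n}, and let S^t and S'^t be the 𝔽_q-bilinear maps determined by tr(S(x,y)·z) = tr(x·S^t(z,y)) and tr(S'(x,y)·z) = tr(x·S'^t(z,y)) for all x,y,z (i.e. for each y, S^t(·,y) is the trace-adjoint of S(·,y)). Suppose A, B, C are invertible 𝔽_q-linear maps of 𝔽_{q^n} with S'(A(x), B(y)) = C(S(x,y)) for all x, y. Then S'^t(Ĉ^{−1}(x), B(y)) = Â^{−1}(S^t(x,y)) for all x, y, where Â and Ĉ denote the trace-adjoints of A and C (which are invertible). In particular, if S is isotopic to S' then S^t is isotopic to S'^t. -/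
/-- The trace form of an extension of finite fields separates points. -/
theorem eq_of_forall_trace_mul_eq {F K : Type*} [Field F] [Field K] [Algebra F K]
    [Finite F] [Finite K] {a b : K}
    (h : ∀ x : K, Algebra.trace F K (x * a) = Algebra.trace F K (x * b)) : a = b := by
  have : FiniteDimensional F K := Module.Finite.of_finite
  refine sub_eq_zero.mp ((traceForm_nondegenerate F K).2 _ fun x => ?_)
  simp [Algebra.traceForm_apply, mul_sub, h x]

/-- The trace-adjoint of a surjective linear map between finite fields is bijective. -/
theorem bijective_of_trace_adjoint {F K : Type*} [Field F] [Field K] [Algebra F K]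
    [Finite F] [Finite K] {f g : K →ₗ[F] K} (hf : Function.Surjective f)
    (h : ∀ x y : K, Algebra.trace F K (f x * y) = Algebra.trace F K (x * g y)) :
    Function.Bijective g := by
  refine Finite.injective_iff_bijective.mp fun a b hab => ?_
  refine eq_of_forall_trace_mul_eq (F := F) fun x => ?_
  obtain ⟨w, rfl⟩ := hf x
  rw [h, h, hab]

/-- if `(A,B,C)` is an isotopism from `S` to `S'`, then
`(Ĉ⁻¹, B, Â⁻¹)` is an isotopism from `S^t` to `S'^t`; in particular isotopic bilinear
maps have isotopic transposes. -/
theorem stmt11 (F K : Type*) [Field F] [Field K] [Algebra F K] [Fintype F] [Fintype K]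
    (S S' St S't : K →ₗ[F] K →ₗ[F] K)
    (hSt : ∀ x y z : K,
      Algebra.trace F K (S x y * z) = Algebra.trace F K (x * St z y))
    (hS't : ∀ x y z : K,
      Algebra.trace F K (S' x y * z) = Algebra.trace F K (x * S't z y))
    (A B C Ahat Chat : K →ₗ[F] K)
    (hA : Function.Bijective ⇑A) (hB : Function.Bijective ⇑B) (hC : Function.Bijective ⇑C)
    (hAhat : ∀ x y : K, Algebra.trace F K (A x * y) = Algebra.trace F K (x * Ahat y))
    (hChat : ∀ x y : K, Algebra.trace F K (C x * y) = Algebra.trace F K (x * Chat y))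
    (hiso : ∀ x y : K, S' (A x) (B y) = C (S x y)) :
    Function.Bijective ⇑Ahat ∧ Function.Bijective ⇑Chat ∧
    (∃ Ainv Cinv : K →ₗ[F] K,
      (∀ x, Ainv (Ahat x) = x ∧ Ahat (Ainv x) = x) ∧
      (∀ x, Cinv (Chat x) = x ∧ Chat (Cinv x) = x) ∧
      ∀ x y : K, S't (Cinv x) (B y) = Ainv (St x y)) ∧
    (∃ A' B' C' : K →ₗ[F] K,
      Function.Bijective ⇑A' ∧ Function.Bijective ⇑B' ∧ Function.Bijective ⇑C' ∧
      ∀ x y : K, S't (A' x) (B' y) = C' (St x y)) := by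
  have hAb := bijective_of_trace_adjoint hA.surjective hAhat
  have hCb := bijective_of_trace_adjoint hC.surjective hChat
  have key (z y : K) : Ahat (S't z (B y)) = St (Chat z) y := by
    refine eq_of_forall_trace_mul_eq (F := F) fun x => ?_
    rw [← hAhat, ← hS't, hiso, hChat, hSt]
  let eA := LinearEquiv.ofBijective Ahat hAb
  let eC := LinearEquiv.ofBijective Chat hCb
  have hCs (x : K) : Chat (eC.symm x) = x := eC.apply_symm_apply x
  have hmain (x y : K) : S't (eC.symm x) (B y) = eA.symm (St x y) := by
    rw [LinearEquiv.eq_symm_apply]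
    exact (key _ y).trans (by rw [hCs])
  exact ⟨hAb, hCb,
    ⟨eA.symm, eC.symm, fun x => ⟨eA.symm_apply_apply x, eA.apply_symm_apply x⟩,
      fun x => ⟨eC.symm_apply_apply x, hCs x⟩, hmain⟩,
    ⟨eC.symm, B, eA.symm, eC.symm.bijective, hB, eA.symm.bijective, hmain⟩⟩
end

section
/- Let S : 𝔽_{q^n} × 𝔽_{q^n} → 𝔽_{q^n} be an 𝔽_q-bilinear map that is symmetric, i.e. S(x,y) = S(y,x) for all x, y. Then there exist r ∈ ℕ and 𝔽_q-linear maps f_1,…,f_r : 𝔽_{q^n} → 𝔽_{q^n} such that S(x,y) = Σ_{k=1}^r f_k(x)·f_k(y) for all x, y ∈ 𝔽_{q^n}. -/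
/-- The functions `V × V → K` of the form `(x, y) ↦ ∑ k, f k x * f k y` with every `f k` linear. -/
def sumLinearSquares (F V K : Type*) [Field F] [Field K] [Algebra F K] [AddCommGroup V]
    [Module F V] : AddSubmonoid (V → V → K) where
  carrier := {T | ∃ (r : ℕ) (f : Fin r → (V →ₗ[F] K)), ∀ x y, T x y = ∑ k, f k x * f k y}
  zero_mem' := ⟨0, Fin.elim0, by simp⟩
  add_mem' := by
    rintro T U ⟨r, f, hf⟩ ⟨s, g, hg⟩
    exact ⟨r + s, Fin.append f g, fun x y => by simp [Fin.sum_univ_add, hf, hg]⟩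

theorem FiniteField.exists_sq_add_sq_eq {K : Type*} [Field K] [Finite K] (c : K) :
    ∃ a b : K, a ^ 2 + b ^ 2 = c := by
  have := Fintype.ofFinite K
  by_cases h : ringChar K = 2
  · obtain ⟨a, rfl⟩ := FiniteField.isSquare_of_char_two h c
    exact ⟨a, 0, by ring⟩
  · obtain ⟨a, b, hab⟩ := FiniteField.exists_root_sum_quadratic
      (f := (Polynomial.X ^ 2 : Polynomial K)) (g := Polynomial.X ^ 2 - Polynomial.C c)
      (by simp) (Polynomial.degree_X_pow_sub_C (by norm_num) c)
      (FiniteField.odd_card_of_char_ne_two h)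
    refine ⟨a, b, ?_⟩
    simp only [Polynomial.eval_sub, Polynomial.eval_pow, Polynomial.eval_X,
      Polynomial.eval_C] at hab
    linear_combination hab

section

variable {F V K : Type*} [Field F] [Field K] [Algebra F K] [Finite K] [AddCommGroup V] [Module F V]

theorem smul_square_mem_sumLinearSquares (c : K) (f : V →ₗ[F] K) :
    (fun x y => c * (f x * f y)) ∈ sumLinearSquares F V K := by
  obtain ⟨a, b, rfl⟩ := FiniteField.exists_sq_add_sq_eq c
  refine ⟨2, ![a • f, b • f], fun x y => ?_⟩
  simp only [Fin.sum_univ_two, Matrix.cons_val_zero, Matrix.cons_val_one, LinearMap.smul_apply,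
    smul_eq_mul]
  ring

theorem smul_symm_mul_mem_sumLinearSquares (c : K) (f g : V →ₗ[F] K) :
    (fun x y => c * (f x * g y + g x * f y)) ∈ sumLinearSquares F V K := by
  convert add_mem (add_mem (smul_square_mem_sumLinearSquares c (f + g))
    (smul_square_mem_sumLinearSquares (-c) f)) (smul_square_mem_sumLinearSquares (-c) g) using 1
  ext x y
  simp only [Pi.add_apply, LinearMap.add_apply]
  ring

theorem symm_sum_mem_sumLinearSquares {ι : Type*} (s : Finset ι) (f : ι → V →ₗ[F] K)
    (c : ι → ι → K) (hc : ∀ i j, c i j = c j i) :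
    (fun x y => ∑ i ∈ s, ∑ j ∈ s, c i j * (f i x * f j y)) ∈ sumLinearSquares F V K := by
  classical
  induction s using Finset.induction_on with
  | empty => exact zero_mem (sumLinearSquares F V K)
  | insert a s ha ih =>
    convert add_mem (add_mem (smul_square_mem_sumLinearSquares (c a a) (f a))
      (sum_mem fun j (_ : j ∈ s) => smul_symm_mul_mem_sumLinearSquares (c a j) (f a) (f j))) ih
      using 1
    ext x y
    simp only [Finset.sum_insert ha, Finset.sum_add_distrib, Pi.add_apply, Finset.sum_apply,
      mul_add, hc _ a]
    ring

theorem LinearMap.mem_sumLinearSquares_of_symm [FiniteDimensional F V] (S : V →ₗ[F] V →ₗ[F] K)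
    (hS : ∀ x y, S x y = S y x) : (fun x y => S x y) ∈ sumLinearSquares F V K := by
  let b := Module.finBasis F V
  convert symm_sum_mem_sumLinearSquares Finset.univ
    (fun i => Algebra.linearMap F K ∘ₗ b.coord i) (fun i j => S (b i) (b j))
    (fun i j => hS _ _) using 1
  ext x y
  rw [← LinearMap.sum_repr_mul_repr_mul b b x y,
    Finsupp.sum_fintype _ _ (by simp)]
  refine Finset.sum_congr rfl fun i _ => ?_
  rw [Finsupp.sum_fintype _ _ (by simp)]
  refine Finset.sum_congr rfl fun j _ => ?_
  simp only [Algebra.smul_def, LinearMap.comp_apply, Module.Basis.coord_apply,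
    Algebra.linearMap_apply]
  ring

end

/-- every symmetric `𝔽_q`-bilinear map `S : 𝔽_{q^n} × 𝔽_{q^n} → 𝔽_{q^n}`
can be written as `S(x,y) = Σ_{k=1}^r f_k(x)·f_k(y)` for some `𝔽_q`-linear maps `f_k`. -/
theorem stmt12 (F K : Type*) [Field F] [Field K] [Algebra F K] [Fintype F] [Fintype K]
    (S : K →ₗ[F] K →ₗ[F] K) (hsymm : ∀ x y : K, S x y = S y x) :
    ∃ (r : ℕ) (f : Fin r → (K →ₗ[F] K)),
      ∀ x y : K, S x y = ∑ k, f k x * f k y := by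
  exact LinearMap.mem_sumLinearSquares_of_symm S hsymm
end

section
/- Let f_1,…,f_r : 𝔽_{q^n} → 𝔽_{q^n} be 𝔽_q-linear maps with trace-adjoints f̂_1,…,f̂_r, and define S(x,y) := Σ_{k=1}^r f̂_k(f_k(x)·y). Then tr(S(x,y)·z) = tr(S(z,y)·x) for all x, y, z ∈ 𝔽_{q^n} (i.e. for each y the right-multiplication map x ↦ S(x,y) is self-adjoint with respect to the trace form). Consequently, for every y ∈ 𝔽_{q^n} the subspace A_y := {(x, S(x,y)) : x ∈ 𝔽_{q^n}} of (𝔽_{q^n})², as well as A_∞ := {(0,x) : x ∈ 𝔽_{q^n}}, is totally isotropic with respect to the alternating form b_ε; that is, the semifield spread defined by S is symplectic. -/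
/-- If each `fhat k` is trace-adjoint to `f k`, then `x ↦ ∑ k, fhat k (f k x * y)` is self-adjoint
with respect to the trace form. -/
theorem trace_sum_adjoint_mul_comm {F K ι : Type*} [CommRing F] [CommRing K] [Algebra F K]
    [Fintype ι] (f fhat : ι → (K →ₗ[F] K))
    (hadj : ∀ k, ∀ x y : K,
      Algebra.trace F K (f k x * y) = Algebra.trace F K (x * fhat k y)) (x y z : K) :
    Algebra.trace F K ((∑ k, fhat k (f k x * y)) * z)
      = Algebra.trace F K ((∑ k, fhat k (f k z * y)) * x) := by
  simp only [Finset.sum_mul, map_sum]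
  refine Finset.sum_congr rfl fun k _ => ?_
  rw [mul_comm _ z, mul_comm _ x, ← hadj, ← hadj, mul_left_comm]

/-- for `S(x,y) = Σ f̂_k(f_k(x)·y)`, the right multiplications are
self-adjoint with respect to the trace form, and consequently each spread element
`A_y = {(x,S(x,y))}`, as well as `A_∞`, is totally isotropic for the alternating form
`b_ε((a,b),(c,d)) = tr(ad − bc)`: the semifield spread defined by `S` is symplectic. -/
theorem stmt13 (F K : Type*) [Field F] [Field K] [Algebra F K] [Fintype F] [Fintype K]
    (r : ℕ) (f fhat : Fin r → (K →ₗ[F] K))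
    (hadj : ∀ k, ∀ x y : K,
      Algebra.trace F K (f k x * y) = Algebra.trace F K (x * fhat k y)) :
    (∀ x y z : K,
      Algebra.trace F K ((∑ k, fhat k (f k x * y)) * z)
        = Algebra.trace F K ((∑ k, fhat k (f k z * y)) * x)) ∧
    (∀ y : K,
      ∀ u ∈ {p : K × K | ∃ x : K, p = (x, ∑ k, fhat k (f k x * y))},
      ∀ v ∈ {p : K × K | ∃ x : K, p = (x, ∑ k, fhat k (f k x * y))},
        Algebra.trace F K (u.1 * v.2 - u.2 * v.1) = 0) ∧
    (∀ u ∈ {p : K × K | p.1 = 0}, ∀ v ∈ {p : K × K | p.1 = 0},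
      Algebra.trace F K (u.1 * v.2 - u.2 * v.1) = 0) := by
  have hS := trace_sum_adjoint_mul_comm f fhat hadj
  refine ⟨hS, ?_, ?_⟩
  · rintro y _ ⟨x, rfl⟩ _ ⟨z, rfl⟩
    rw [map_sub, sub_eq_zero, mul_comm x]
    exact hS z y x
  · intro u hu v hv
    simp [show u.1 = 0 from hu, show v.1 = 0 from hv]
end

section
/- Let f = (f_1,…,f_r) and g = (g_1,…,g_r) be r-tuples of 𝔽_q-linear maps 𝔽_{q^n} → 𝔽_{q^n} such that x ↦ (f_1(x),…,f_r(x)) is injective, dim_{𝔽_q} W_g = rn − n, and no nonzero vector of U_f is an 𝔽_{q^n}-scalar multiple of a nonzero vector of W_g (i.e. (U_f, W_g) is a BEL-configuration). Then ψ_g(U_f) is an n-dimensional 𝔽_q-subspace of End_{𝔽_q}(𝔽_{q^n}) every nonzero element of which is bijective, and ψ_g(U_f) equals the set of left-multiplication maps {y ↦ S_{f,g}(x,y) : x ∈ 𝔽_{q^n}}. -/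
/-- The `𝔽_q`-linear map `ψ_g : (𝔽_{q^n})^r → End_{𝔽_q}(𝔽_{q^n})`,
`ψ_g(v) = (z ↦ Σ g_i(v_i·z))`. -/
noncomputable def psiMap (F K : Type*) [Field F] [Field K] [Algebra F K]
    (r : ℕ) (g : Fin r → (K →ₗ[F] K)) : (Fin r → K) →ₗ[F] (K →ₗ[F] K) where
  toFun v :=
    { toFun := fun z => ∑ i, g i (v i * z)
      map_add' := by
        intro z w
        simp [mul_add, map_add, Finset.sum_add_distrib]
      map_smul' := by
        intro c z
        simp [mul_smul_comm, map_smul, Finset.smul_sum] }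
  map_add' := by
    intro v w
    ext z
    simp [add_mul, map_add, Finset.sum_add_distrib]
  map_smul' := by
    intro c v
    ext z
    simp [smul_mul_assoc, map_smul, Finset.smul_sum]

/-- If no nonzero vector of `U_f` is a scalar multiple of a nonzero vector of `W_g`, then the
multiplication `S_{f,g}` has no zero divisors. -/
theorem psiMap_pi_injective {F K : Type*} [Field F] [Field K] [Algebra F K] {r : ℕ}
    {f g : Fin r → (K →ₗ[F] K)}
    (hf : Function.Injective ⇑(LinearMap.pi f))
    (hBEL : ¬ ∃ u ∈ {u : Fin r → K | ∃ x : K, u = fun i => f i x}, u ≠ 0 ∧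
      ∃ w ∈ {w : Fin r → K | ∑ i, g i (w i) = 0}, w ≠ 0 ∧
        ∃ α : K, u = fun i => α * w i)
    {x : K} (hx : x ≠ 0) : Function.Injective ⇑(psiMap F K r g (LinearMap.pi f x)) := by
  rw [injective_iff_map_eq_zero]
  intro z hz
  by_contra hz0
  have hu : LinearMap.pi f x ≠ 0 := (map_ne_zero_iff _ hf).2 hx
  refine hBEL ⟨LinearMap.pi f x, ⟨x, rfl⟩, hu, fun i => f i x * z, hz, fun h => hu ?_, z⁻¹, ?_⟩
  · ext i
    exact (mul_eq_zero.1 (congrFun h i)).resolve_right hz0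
  · ext i
    simp only [LinearMap.pi_apply]
    field_simp

/-- if `(U_f, W_g)` is a BEL-configuration then `ψ_g(U_f)` is an
`n`-dimensional subspace of `End_{𝔽_q}(𝔽_{q^n})` all of whose nonzero elements are
bijective, and it equals the set of left multiplications of `S_{f,g}`. -/
theorem stmt16 (F K : Type*) [Field F] [Field K] [Algebra F K] [Fintype F] [Fintype K]
    (n r : ℕ) (hn : Module.finrank F K = n) (hr : 2 ≤ r)
    (f g : Fin r → (K →ₗ[F] K))
    (hf : Function.Injective ⇑(LinearMap.pi f))
    (hWg : Module.finrank F
      (LinearMap.ker (∑ i, (g i) ∘ₗ (LinearMap.proj i : (Fin r → K) →ₗ[F] K)))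
        = r * n - n)
    (hBEL : ¬ ∃ u ∈ {u : Fin r → K | ∃ x : K, u = fun i => f i x}, u ≠ 0 ∧
      ∃ w ∈ {w : Fin r → K | ∑ i, g i (w i) = 0}, w ≠ 0 ∧
        ∃ α : K, u = fun i => α * w i) :
    Module.finrank F
        (Submodule.map (psiMap F K r g) (LinearMap.range (LinearMap.pi f))) = n ∧
    (∀ h ∈ Submodule.map (psiMap F K r g) (LinearMap.range (LinearMap.pi f)),
      h ≠ 0 → Function.Bijective ⇑h) ∧
    ((Submodule.map (psiMap F K r g) (LinearMap.range (LinearMap.pi f)) :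
        Set (K →ₗ[F] K))
      = {h : K →ₗ[F] K | ∃ x : K, ∀ z : K, h z = ∑ i, g i (f i x * z)}) := by
  have inj {x : K} (hx : x ≠ 0) := psiMap_pi_injective hf hBEL hx
  have hcomp : Function.Injective ⇑(psiMap F K r g ∘ₗ LinearMap.pi f) := by
    rw [injective_iff_map_eq_zero]
    intro x hx
    by_contra hx0
    refine one_ne_zero (inj hx0 (?_ : _ = psiMap F K r g (LinearMap.pi f x) 0))
    rw [LinearMap.comp_apply] at hx
    simp [hx]
  refine ⟨?_, ?_, ?_⟩
  · rw [← LinearMap.range_comp, LinearMap.finrank_range_of_inj hcomp, hn]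
  · rintro _ ⟨_, ⟨x, rfl⟩, rfl⟩ h0
    refine Finite.injective_iff_bijective.1 (inj ?_)
    rintro rfl
    simp at h0
  · ext h
    constructor
    · rintro ⟨_, ⟨x, rfl⟩, rfl⟩
      exact ⟨x, fun _ => rfl⟩
    · rintro ⟨x, hx⟩
      exact ⟨_, ⟨x, rfl⟩, LinearMap.ext fun z => (hx z).symm⟩
end

section
/- Let U and W be n-dimensional 𝔽_q-subspaces of (𝔽_{q^n})² such that no nonzero vector of U is an 𝔽_{q^n}-scalar multiple of a nonzero vector of W (i.e. (U,W) is a BEL-configuration in V(2n,q)). Then there exist 𝔽_q-linear maps a, b : 𝔽_{q^n} → 𝔽_{q^n} and an 𝔽_{q^n}-linear automorphism φ of (𝔽_{q^n})² with φ(U) = {(x, a(x)) : x ∈ 𝔽_{q^n}} and φ(W) = {(−b(y), y) : y ∈ 𝔽_{q^n}}, and moreover both x·y + b(a(x)·y) ≠ 0 and x·y + a(b(x)·y) ≠ 0 for all nonzero x, y ∈ 𝔽_{q^n}; that is, both xy + b(a(x)y) and xy + a(b(x)y) (the multiplication of the semifield of (U,W) and of the switched configuration (W,U)) are presemifield multiplications.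 -/
/-- A subspace of the dimension of `E` on which the linear map `f` has trivial kernel
admits a linear section of `f`. -/
theorem exists_linear_section {F E M : Type*} [Field F] [AddCommGroup E] [Module F E]
    [AddCommGroup M] [Module F M] [FiniteDimensional F E] [FiniteDimensional F M]
    (V : Submodule F M) (hV : Module.finrank F V = Module.finrank F E) (f : M →ₗ[F] E)
    (hf : ∀ v ∈ V, f v = 0 → v = 0) :
    ∃ g : E →ₗ[F] M, (∀ x, g x ∈ V) ∧ (∀ x, f (g x) = x) ∧ ∀ v ∈ V, g (f v) = v := by
  have hinj : Function.Injective (f ∘ₗ V.subtype) := by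
    rw [injective_iff_map_eq_zero]
    exact fun v hv => Subtype.ext (hf v v.2 hv)
  let e : V ≃ₗ[F] E := LinearEquiv.ofBijective (f ∘ₗ V.subtype)
    ⟨hinj, (LinearMap.injective_iff_surjective_of_finrank_eq_finrank hV).1 hinj⟩
  refine ⟨V.subtype ∘ₗ e.symm.toLinearMap, fun x => (e.symm x).2, fun x => ?_, fun v hv => ?_⟩
  · exact e.apply_symm_apply x
  · exact congrArg Subtype.val (e.symm_apply_apply ⟨v, hv⟩)

/-- Two vectors of the plane `K × K` that are not proportional are the preimages of the standard
basis under an automorphism. -/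
theorem exists_linearEquiv_standard_basis {K : Type*} [Field K] (u w : K × K) (hw : w ≠ 0)
    (huw : ∀ α : K, u ≠ α • w) :
    ∃ φ : (K × K) ≃ₗ[K] (K × K), ∀ p, p = (φ p).1 • u + (φ p).2 • w := by
  let θ : (K × K) →ₗ[K] (K × K) :=
    (LinearMap.toSpanSingleton K _ u).coprod (LinearMap.toSpanSingleton K _ w)
  have hθ : ∀ p, θ p = p.1 • u + p.2 • w := fun p => by simp [θ]
  have hinj : Function.Injective θ := by
    rw [injective_iff_map_eq_zero]
    rintro ⟨s, t⟩ h
    rw [hθ] at h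
    have hs : s = 0 := by
      by_contra hs
      refine huw (-(s⁻¹ * t)) ?_
      rw [neg_smul, mul_smul, ← smul_neg, ← eq_neg_of_add_eq_zero_left h, inv_smul_smul₀ hs]
    have ht : t = 0 := by simpa [hs, hw] using h
    rw [hs, ht, Prod.mk_zero_zero]
  refine ⟨(LinearEquiv.ofInjectiveEndo θ hinj).symm, fun p => ?_⟩
  rw [← hθ]
  exact ((LinearEquiv.ofInjectiveEndo θ hinj).apply_symm_apply p).symm

/-- every BEL-configuration `(U,W)` in `(𝔽_{q^n})²` can be put in the
form `U = {(x,a(x))}`, `W = {(−b(y),y)}` by an `𝔽_{q^n}`-linear automorphism, and both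
`xy + b(a(x)y)` and `xy + a(b(x)y)` are presemifield multiplications. -/
theorem stmt18 (F K : Type*) [Field F] [Field K] [Algebra F K] [Fintype F] [Fintype K]
    (n : ℕ) (hn : Module.finrank F K = n)
    (U W : Submodule F (K × K))
    (hU : Module.finrank F U = n) (hW : Module.finrank F W = n)
    (hBEL : ¬ ∃ u ∈ U, u ≠ 0 ∧ ∃ w ∈ W, w ≠ 0 ∧ ∃ α : K, u = α • w) :
    ∃ (a b : K →ₗ[F] K) (φ : (K × K) ≃ₗ[K] (K × K)),
      (⇑φ '' (U : Set (K × K)) = {p : K × K | ∃ x : K, p = (x, a x)}) ∧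
      (⇑φ '' (W : Set (K × K)) = {p : K × K | ∃ y : K, p = (-(b y), y)}) ∧
      (∀ x y : K, x ≠ 0 → y ≠ 0 → x * y + b (a x * y) ≠ 0) ∧
      (∀ x y : K, x ≠ 0 → y ≠ 0 → x * y + a (b x * y) ≠ 0) := by
  have hpos : 0 < n := hn ▸ Module.finrank_pos
  have exists_ne (V : Submodule F (K × K)) (hV : Module.finrank F V = n) : ∃ v ∈ V, v ≠ 0 := by
    refine V.exists_mem_ne_zero_of_ne_bot ?_
    rintro rfl
    rw [finrank_bot] at hV
    omega
  obtain ⟨u, hu, hu0⟩ := exists_ne U hU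
  obtain ⟨w, hw, hw0⟩ := exists_ne W hW
  have hind : ∀ u ∈ U, u ≠ 0 → ∀ w ∈ W, ∀ α : K, u ≠ α • w := by
    rintro u hu hu0 w hw α rfl
    exact hBEL ⟨_, hu, hu0, w, hw, fun h => hu0 (by rw [h, smul_zero]), α, rfl⟩
  obtain ⟨φ, hφ⟩ := exists_linearEquiv_standard_basis u w hw0 (hind u hu hu0 w hw)
  let ψ : (K × K) →ₗ[F] (K × K) := φ.toLinearMap.restrictScalars F
  obtain ⟨g, hgU, hg, hg'⟩ := exists_linear_section U (hU.trans hn.symm)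
    (LinearMap.fst F K K ∘ₗ ψ) fun v hv (h : (φ v).1 = 0) => by
      by_contra hv0
      refine hind v hv hv0 w hw (φ v).2 ?_
      conv_lhs => rw [hφ v, h, zero_smul, zero_add]
  obtain ⟨k, hkW, hk, hk'⟩ := exists_linear_section W (hW.trans hn.symm)
    (LinearMap.snd F K K ∘ₗ ψ) fun v hv (h : (φ v).2 = 0) => by
      by_contra hv0
      have hv1 : v = (φ v).1 • u := by
        conv_lhs => rw [hφ v, h, zero_smul, add_zero]
      have h1 : (φ v).1 ≠ 0 := fun h1 => hv0 (by rw [hv1, h1, zero_smul])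
      exact hind u hu hu0 v hv (φ v).1⁻¹ ((eq_inv_smul_iff₀ h1).2 hv1.symm)
  let a : K →ₗ[F] K := LinearMap.snd F K K ∘ₗ ψ ∘ₗ g
  let b : K →ₗ[F] K := -(LinearMap.fst F K K ∘ₗ ψ ∘ₗ k)
  have ha : ∀ x, φ (g x) = (x, a x) := fun x => Prod.ext (hg x) rfl
  have hb : ∀ y, φ (k y) = (-(b y), y) := fun y =>
    Prod.ext (neg_neg (φ (k y)).1).symm (hk y)
  have hgraph (x y α : K) (hx : (x, a x) ≠ (0 : K × K)) : (x, a x) ≠ α • (-(b y), y) := by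
    rw [← ha, ← hb, ← map_smul]
    exact fun h => hind (g x) (hgU x) (fun h0 => hx (by rw [← ha, h0, map_zero])) (k y) (hkW y) α
      (φ.injective h)
  refine ⟨a, b, φ, ?_, ?_, fun x y hx hy h => ?_, fun x y hx hy h => ?_⟩
  · ext p
    constructor
    · rintro ⟨v, hv, rfl⟩
      exact ⟨(φ v).1, by rw [← ha]; exact congrArg φ (hg' v hv).symm⟩
    · rintro ⟨x, rfl⟩
      exact ⟨g x, hgU x, ha x⟩
  · ext p
    constructor
    · rintro ⟨v, hv, rfl⟩
      exact ⟨(φ v).2, by rw [← hb]; exact congrArg φ (hk' v hv).symm⟩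
    · rintro ⟨y, rfl⟩
      exact ⟨k y, hkW y, hb y⟩
  · refine hgraph x (a x * y) y⁻¹ (fun h0 => hx (congrArg Prod.fst h0)) ?_
    rw [← eq_neg_of_add_eq_zero_left h]
    ext <;> simp <;> field_simp
  · have hz : a (-(b x * y)) = x * y := by
      rw [map_neg, ← eq_neg_of_add_eq_zero_left h]
    refine hgraph (-(b x * y)) x y (fun h0 => ?_) ?_
    · exact mul_ne_zero hx hy (hz ▸ congrArg Prod.snd h0)
    · rw [hz]
      ext <;> simp [mul_comm]
end

section
/- Let U and W be n-dimensional 𝔽_q-subspaces of (𝔽_{q^n})² such that no nonzero vector of U is an 𝔽_{q^n}-scalar multiple of a nonzero vector of W (i.e. (U,W) is a BEL-configuration in V(2n,q)). Then (U^ε, W) is also a BEL-configuration: dim_{𝔽_q} U^ε = n and no nonzero vector of U^ε is an 𝔽_{q^n}-scalar multiple of a nonzero vector of W. -/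
/-- The polarity `ε` of `(𝔽_{q^n})²` induced by the alternating form
`b_ε((a,b),(c,d)) = tr(ad − bc)`: the subspace `M^ε`. -/
def epsPerp (F K : Type*) [Field F] [Field K] [Algebra F K]
    (M : Submodule F (K × K)) : Submodule F (K × K) where
  carrier := {v | ∀ u ∈ M, Algebra.trace F K (u.1 * v.2 - u.2 * v.1) = 0}
  zero_mem' := by
    intro u hu
    simp
  add_mem' := by
    intro a b ha hb u hu
    have h1 := ha u hu
    have h2 := hb u hu
    have hh : u.1 * (a + b).2 - u.2 * (a + b).1
        = (u.1 * a.2 - u.2 * a.1) + (u.1 * b.2 - u.2 * b.1) := by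
      simp only [Prod.snd_add, Prod.fst_add]
      ring
    rw [hh, map_add, h1, h2, add_zero]
  smul_mem' := by
    intro c v hv u hu
    have h1 := hv u hu
    have hh : u.1 * (c • v).2 - u.2 * (c • v).1 = c • (u.1 * v.2 - u.2 * v.1) := by
      simp only [Prod.smul_snd, Prod.smul_fst, smul_sub, mul_smul_comm]
    rw [hh, map_smul, h1, smul_zero]

/-- The alternating trace form `b((a,b),(c,d)) = tr(ad − bc)` on `K × K`. -/
noncomputable def epsForm (F K : Type*) [Field F] [Field K] [Algebra F K] :
    LinearMap.BilinForm F (K × K) :=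
  LinearMap.mk₂ F (fun u v => Algebra.trace F K (u.1 * v.2 - u.2 * v.1))
    (fun u u' v => by rw [← map_add]; congr 1; simp only [Prod.fst_add, Prod.snd_add]; ring)
    (fun c u v => by rw [← map_smul]; congr 1; simp [smul_sub])
    (fun u v v' => by rw [← map_add]; congr 1; simp only [Prod.fst_add, Prod.snd_add]; ring)
    (fun c u v => by rw [← map_smul]; congr 1; simp [smul_sub])

section epsForm

variable {F K : Type*} [Field F] [Field K] [Algebra F K]

theorem epsForm_apply (u v : K × K) :
    epsForm F K u v = Algebra.trace F K (u.1 * v.2 - u.2 * v.1) := rfl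

theorem epsForm_isRefl : LinearMap.IsRefl (epsForm F K) := by
  intro u v h
  rw [epsForm_apply] at h ⊢
  rw [← neg_eq_zero, ← map_neg, ← h]
  congr 1
  ring

theorem epsPerp_eq_orthogonal (M : Submodule F (K × K)) :
    epsPerp F K M = (epsForm F K).orthogonal M := rfl

theorem eq_zero_of_forall_epsForm_eq_zero [FiniteDimensional F K] [Algebra.IsSeparable F K]
    {v : K × K} (h : ∀ u, epsForm F K u v = 0) : v = 0 := by
  have key : ∀ y : K, (∀ x, Algebra.trace F K (x * y) = 0) → y = 0 := fun y hy =>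
    (traceForm_nondegenerate F K).2 y hy
  refine Prod.ext (key _ fun x => ?_) (key _ fun x => ?_)
  · simpa [epsForm_apply] using h (0, x)
  · simpa [epsForm_apply] using h (x, 0)

theorem epsForm_nondegenerate [FiniteDimensional F K] [Algebra.IsSeparable F K] :
    (epsForm F K).Nondegenerate :=
  epsForm_isRefl.nondegenerate_iff_separatingRight.2
    fun _ h => eq_zero_of_forall_epsForm_eq_zero h

theorem finrank_restrictScalars_span_singleton {V : Type*} [AddCommGroup V] [Module F V]
    [Module K V] [IsScalarTower F K V] {w : V} (hw : w ≠ 0) :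
    Module.finrank F ((Submodule.span K {w}).restrictScalars F) = Module.finrank F K :=
  ((LinearEquiv.toSpanNonzeroSingleton K V w hw).restrictScalars F).finrank_eq.symm

/-- If `Uᗮ` meets the `K`-line of `w` nontrivially, then so does `U`, for `U` of dimension
`[K : F]`. -/
theorem exists_smul_mem_of_smul_mem_epsPerp [FiniteDimensional F K] [Algebra.IsSeparable F K]
    {U : Submodule F (K × K)} (hU : Module.finrank F U = Module.finrank F K) {w : K × K}
    {α : K} (hα : α • w ∈ epsPerp F K U) (h0 : α • w ≠ 0) :
    ∃ β : K, β • w ∈ U ∧ β • w ≠ 0 := by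
  by_contra! h
  have hw : w ≠ 0 := by rintro rfl; simp at h0
  set P := (Submodule.span K {w}).restrictScalars F with hP
  have hdisj : U ⊓ P = ⊥ := by
    rw [Submodule.eq_bot_iff]
    rintro x ⟨hxU, hxP⟩
    obtain ⟨β, rfl⟩ := Submodule.mem_span_singleton.1 hxP
    exact h β hxU
  have htop : U ⊔ P = ⊤ := by
    apply Submodule.eq_top_of_disjoint U P
    · rw [hU, hP, finrank_restrictScalars_span_singleton hw, Module.finrank_prod]
    · exact disjoint_iff.2 hdisj
  refine h0 (eq_zero_of_forall_epsForm_eq_zero (F := F) fun x => ?_)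
  obtain ⟨u, hu, p, hp, rfl⟩ := Submodule.mem_sup.1 (htop ▸ Submodule.mem_top : x ∈ U ⊔ P)
  obtain ⟨β, rfl⟩ := Submodule.mem_span_singleton.1 hp
  have hPP : epsForm F K (β • w) (α • w) = 0 := by
    rw [epsForm_apply, ← map_zero (Algebra.trace F K)]
    congr 1
    simp only [Prod.smul_fst, Prod.smul_snd, smul_eq_mul]
    ring
  rw [map_add, LinearMap.add_apply, hPP, add_zero]
  exact hα u hu

end epsForm


/-- if `(U,W)` is a BEL-configuration in `(𝔽_{q^n})²`, then so is
`(U^ε, W)`: `dim U^ε = n` and no nonzero vector of `U^ε` is an `𝔽_{q^n}`-scalar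
multiple of a nonzero vector of `W`. -/
theorem stmt19 (F K : Type*) [Field F] [Field K] [Algebra F K] [Fintype F] [Fintype K]
    (n : ℕ) (hn : Module.finrank F K = n)
    (U W : Submodule F (K × K))
    (hU : Module.finrank F U = n) (hW : Module.finrank F W = n)
    (hBEL : ¬ ∃ u ∈ U, u ≠ 0 ∧ ∃ w ∈ W, w ≠ 0 ∧ ∃ α : K, u = α • w) :
    Module.finrank F (epsPerp F K U) = n ∧
    ¬ ∃ u ∈ epsPerp F K U, u ≠ 0 ∧ ∃ w ∈ W, w ≠ 0 ∧ ∃ α : K, u = α • w := by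
  subst hn
  refine ⟨?_, ?_⟩
  · rw [epsPerp_eq_orthogonal,
      LinearMap.BilinForm.finrank_orthogonal epsForm_nondegenerate,
      Module.finrank_prod, hU, Nat.add_sub_cancel]
  · rintro ⟨_, hu, hu0, w, hw, hw0, α, rfl⟩
    obtain ⟨β, hβ, hβ0⟩ := exists_smul_mem_of_smul_mem_epsPerp hU hu hu0
    exact hBEL ⟨_, hβ, hβ0, w, hw, hw0, β, rfl⟩
end
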